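/- arXiv:1907.00335 — 4 statements merged into one kernel-verified Lean document; each statement's English description precedes it below -/
import Mathlib

section
/- Let H be a real Hilbert space with a direct sum decomposition H = U ⊕ V, where U is a closed subspace and V is a finite dimensional subspace, with projections Π_U and Π_V. Let D ⊆ H be a linear subspace and A : D → H a linear map such that V ⊆ D and A(V) ⊆ V. Let α : H → H be a map, and let ψ : ℝ₊ → H be a continuously differentiable curve with ψ(t) ∈ D and derivative ψ'(t) = A ψ(t) + Π_U α(ψ(t)) for all t ∈ ℝ₊. Then: (1) ψ(t) + v ∈ D for all t ∈ ℝ₊ and v ∈ V; and (2) for every t ∈ ℝ₊ and v ∈ V, the tangential condition A(ψ(t)+v) + α(ψ(t)+v) ∈ ψ'(t) + V holds if and only if Π_U α(ψ(t)+v) = Π_U α(ψ(t)). -/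
/-- Relation between the drift condition and the tangential condition.
Let `H = U ⊕ V` with `U` closed and `V` finite dimensional, let `A : D → H` be linear with
`V ⊆ D` and `A(V) ⊆ V`, let `α : H → H`, and let `ψ` be a `C¹`-curve on `ℝ₊` with values in
`D` solving `ψ'(t) = A ψ(t) + Π_U α(ψ(t))`.  Then (1) `ψ(t) + v ∈ D` for all `t ≥ 0`, `v ∈ V`,
and (2) the tangential condition `A(ψ(t)+v) + α(ψ(t)+v) ∈ ψ'(t) + V` holds iff
`Π_U α(ψ(t)+v) = Π_U α(ψ(t))`. -/
theorem stmt5 {H : Type*} [NormedAddCommGroup H] [InnerProductSpace ℝ H] [CompleteSpace H]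
    (U V : Submodule ℝ H) (hU : IsClosed (U : Set H)) [FiniteDimensional ℝ V]
    (hcompl : IsCompl U V)
    (D : Submodule ℝ H) (A : D →ₗ[ℝ] H) (hVD : V ≤ D)
    (hAV : ∀ (v : H) (hv : v ∈ D), v ∈ V → A ⟨v, hv⟩ ∈ V)
    (α : H → H) (ψ ψ' : ℝ → H)
    (hψD : ∀ t : ℝ, 0 ≤ t → ψ t ∈ D)
    (hC1 : ∀ (t : ℝ), 0 ≤ t → HasDerivWithinAt ψ (ψ' t) (Set.Ici 0) t)
    (hψ'cont : ContinuousOn ψ' (Set.Ici 0))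
    (hψ'eq : ∀ (t : ℝ) (ht : 0 ≤ t),
      ψ' t = A ⟨ψ t, hψD t ht⟩ + (U.linearProjOfIsCompl V hcompl (α (ψ t)) : H)) :
    (∀ (t : ℝ), 0 ≤ t → ∀ v ∈ V, ψ t + v ∈ D) ∧
    (∀ (t : ℝ), 0 ≤ t → ∀ v ∈ V, ∀ (hmem : ψ t + v ∈ D),
      ((∃ w ∈ V, A ⟨ψ t + v, hmem⟩ + α (ψ t + v) = ψ' t + w) ↔
        U.linearProjOfIsCompl V hcompl (α (ψ t + v)) =
          U.linearProjOfIsCompl V hcompl (α (ψ t)))) := by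
  refine ⟨fun t ht v hv => D.add_mem (hψD t ht) (hVD hv), fun t ht v hv hmem => ?_⟩
  have hA : A ⟨ψ t + v, hmem⟩ = A ⟨ψ t, hψD t ht⟩ + A ⟨v, hVD hv⟩ := by
    rw [← map_add]; rfl
  have hAv := hAV v (hVD hv) hv
  rw [hA, hψ'eq t ht]
  set P := U.linearProjOfIsCompl V hcompl with hP
  have hP0 : ∀ x, P x = 0 ↔ x ∈ V := fun x =>
    Submodule.linearProjOfIsCompl_apply_eq_zero_iff hcompl
  have hPU : ∀ u : U, P (u : H) = u := fun u =>
    Submodule.linearProjOfIsCompl_apply_left hcompl u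
  constructor
  · rintro ⟨w, hw, h⟩
    have h2 : A ⟨v, hVD hv⟩ + α (ψ t + v) = (P (α (ψ t)) : H) + w := by
      rw [add_assoc, add_assoc] at h
      exact add_left_cancel h
    have h3 := congrArg P h2
    rw [map_add, map_add, (hP0 _).2 hAv, (hP0 _).2 hw, hPU, zero_add, add_zero] at h3
    exact h3
  · intro h
    refine ⟨A ⟨v, hVD hv⟩ + (α (ψ t + v) - (P (α (ψ t)) : H)), V.add_mem hAv ?_, by abel⟩
    rw [← hP0, map_sub, hPU, h, sub_self]
end

section
/- Let V be a finite dimensional subspace of the real vector space of differentiable functions ℝ₊ → ℝ such that V is invariant under differentiation, i.e., f' ∈ V for every f ∈ V. Define T f (x) := ∫₀ˣ f(y) dy and let P(V) be the linear span of all products h · (T f) with h, f ∈ V. Then the subspace V + P(V) is finite dimensional, with dim(V + P(V)) ≤ dim V + (dim V)², and V + P(V) is again invariant under differentiation: g' ∈ V + P(V) for every g ∈ V + P(V). -/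
/-- The bilinear map `(h, f) ↦ h · T f` on `V`. -/
noncomputable def prodT (V : Submodule ℝ (ℝ → ℝ)) (hc : ∀ f ∈ V, Continuous f) :
    V →ₗ[ℝ] V →ₗ[ℝ] (ℝ → ℝ) :=
  LinearMap.mk₂ ℝ (fun h f => fun x => (h : ℝ → ℝ) x * ∫ y in (0:ℝ)..x, (f : ℝ → ℝ) y)
    (by intro a b c; funext x; simp [add_mul])
    (by intro a b c; funext x; simp [mul_assoc])
    (by
      intro a b c; funext x
      have := intervalIntegral.integral_add (μ := MeasureTheory.volume)
        ((hc b b.2).intervalIntegrable 0 x) ((hc c c.2).intervalIntegrable 0 x)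
      simp [this, mul_add])
    (by intro a b c; funext x; simp [mul_left_comm])

/-- Lemma on products, cf. Lemma `lemma-product`.
Let `V` be a finite dimensional subspace of the space of differentiable real functions which
is invariant under differentiation.  With `T f (x) = ∫₀ˣ f(y) dy` and
`P(V) = span { h · (T f) : h, f ∈ V }`, the subspace `V + P(V)` is finite dimensional with
`dim (V + P(V)) ≤ dim V + (dim V)²`, and `V + P(V)` is again invariant under
differentiation. -/
theorem stmt6 (V : Submodule ℝ (ℝ → ℝ)) [FiniteDimensional ℝ V]
    (hdiff : ∀ f ∈ V, Differentiable ℝ f)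
    (hinv : ∀ f ∈ V, deriv f ∈ V) :
    FiniteDimensional ℝ
      ↥(V ⊔ Submodule.span ℝ
        {g : ℝ → ℝ | ∃ h ∈ V, ∃ f ∈ V, g = fun x => h x * ∫ y in (0:ℝ)..x, f y}) ∧
    Module.finrank ℝ
      ↥(V ⊔ Submodule.span ℝ
        {g : ℝ → ℝ | ∃ h ∈ V, ∃ f ∈ V, g = fun x => h x * ∫ y in (0:ℝ)..x, f y})
      ≤ Module.finrank ℝ V + (Module.finrank ℝ V) ^ 2 ∧
    ∀ g ∈ (V ⊔ Submodule.span ℝ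
        {g : ℝ → ℝ | ∃ h ∈ V, ∃ f ∈ V, g = fun x => h x * ∫ y in (0:ℝ)..x, f y}),
      deriv g ∈ (V ⊔ Submodule.span ℝ
        {g : ℝ → ℝ | ∃ h ∈ V, ∃ f ∈ V, g = fun x => h x * ∫ y in (0:ℝ)..x, f y}) := by
  have hc : ∀ f ∈ V, Continuous f := fun f hf => (hdiff f hf).continuous
  set S : Set (ℝ → ℝ) :=
    {g : ℝ → ℝ | ∃ h ∈ V, ∃ f ∈ V, g = fun x => h x * ∫ y in (0:ℝ)..x, f y} with hS
  have hle : Submodule.span ℝ S ≤ LinearMap.range (TensorProduct.lift (prodT V hc)) := by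
    rw [Submodule.span_le]
    rintro g ⟨h, hh, f, hf, rfl⟩
    exact ⟨TensorProduct.tmul ℝ ⟨h, hh⟩ ⟨f, hf⟩, by simp [prodT]⟩
  haveI hfin : FiniteDimensional ℝ (Submodule.span ℝ S) :=
    Submodule.finiteDimensional_of_le hle
  have hrank : Module.finrank ℝ (Submodule.span ℝ S) ≤ (Module.finrank ℝ V) ^ 2 := by
    refine (Submodule.finrank_mono hle).trans ((LinearMap.finrank_range_le _).trans ?_)
    rw [Module.finrank_tensorProduct, sq]
  refine ⟨inferInstance, ?_, ?_⟩
  · exact (Submodule.finrank_add_le_finrank_add_finrank _ _).trans (by omega)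
  · have hT : ∀ f ∈ V, ∀ x, HasDerivAt (fun x => ∫ y in (0:ℝ)..x, f y) (f x) x := fun f hf x =>
      intervalIntegral.integral_hasDerivAt_right ((hc f hf).intervalIntegrable 0 x)
        (hc f hf).stronglyMeasurable.stronglyMeasurableAtFilter (hc f hf).continuousAt
    have hmem : ∀ h ∈ V, ∀ f ∈ V, (fun x => h x * ∫ y in (0:ℝ)..x, f y) ∈ V ⊔ Submodule.span ℝ S :=
      fun h hh f hf => Submodule.mem_sup_right (Submodule.subset_span ⟨h, hh, f, hf, rfl⟩)
    have key : ∀ g ∈ Submodule.span ℝ S,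
        Differentiable ℝ g ∧ deriv g ∈ V ⊔ Submodule.span ℝ S := by
      intro g hg
      induction hg using Submodule.span_induction with
      | mem g hg =>
        obtain ⟨h, hh, f, hf, rfl⟩ := hg
        have hd : ∀ x, HasDerivAt (fun x => h x * ∫ y in (0:ℝ)..x, f y)
            (deriv h x * (∫ y in (0:ℝ)..x, f y) + h x * f x) x := fun x =>
          ((hdiff h hh) x).hasDerivAt.mul (hT f hf x)
        refine ⟨fun x => (hd x).differentiableAt, ?_⟩
        have e : deriv (fun x => h x * ∫ y in (0:ℝ)..x, f y) =
            (fun x => deriv h x * ∫ y in (0:ℝ)..x, f y) +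
            ((fun x => h x * ∫ y in (0:ℝ)..x, deriv f y) + f 0 • h) := by
          funext x
          have h2 : ∫ y in (0:ℝ)..x, deriv f y = f x - f 0 :=
            intervalIntegral.integral_deriv_eq_sub (fun y _ => hdiff f hf y)
              ((hc _ (hinv f hf)).intervalIntegrable 0 x)
          rw [(hd x).deriv]
          simp only [Pi.add_apply, Pi.smul_apply, smul_eq_mul, h2]
          ring
        rw [e]
        exact add_mem (hmem _ (hinv h hh) f hf) (add_mem (hmem h hh _ (hinv f hf))
          (Submodule.mem_sup_left (V.smul_mem _ hh)))
      | zero =>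
        refine ⟨differentiable_const 0, ?_⟩
        have : deriv (0 : ℝ → ℝ) = 0 := by funext x; simp
        rw [this]; exact zero_mem _
      | add a b _ _ ha hb =>
        refine ⟨ha.1.add hb.1, ?_⟩
        have : deriv (a + b) = deriv a + deriv b := by
          funext x; exact deriv_add (ha.1 x) (hb.1 x)
        rw [this]; exact add_mem ha.2 hb.2
      | smul c a _ ha =>
        refine ⟨ha.1.const_smul c, ?_⟩
        have : deriv (c • a) = c • deriv a := by
          funext x; exact deriv_const_smul c (ha.1 x)
        rw [this]; exact Submodule.smul_mem _ _ ha.2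
    intro g hg
    obtain ⟨a, ha, b, hb, rfl⟩ := Submodule.mem_sup.1 hg
    have : deriv (a + b) = deriv a + deriv b := by
      funext x; exact deriv_add (hdiff a ha x) ((key b hb).1 x)
    rw [this]
    exact add_mem (Submodule.mem_sup_left (hinv a ha)) (key b hb).2
end

section
/- Let f : ℝ → ℝ be a function. Then the following are equivalent: (i) f belongs to some finite dimensional subspace V of the space of smooth functions ℝ → ℝ which is invariant under differentiation (g' ∈ V for all g ∈ V); (ii) there exist finite sets I ⊂ ℝ and J ⊂ ℝ × (0,∞) and an integer p ∈ ℕ₀ such that f is a finite real linear combination of the functions x ↦ x^j exp(λ x) for λ ∈ I and j = 0,…,p, together with the functions x ↦ x^j exp(μ x) cos(ν x) and x ↦ x^j exp(μ x) sin(ν x) for (μ,ν) ∈ J and j = 0,…,p. -/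
open Polynomial in
/-- Every complex polynomial has an antiderivative. -/
lemma qe_exists_antideriv (P : ℂ[X]) : ∃ R : ℂ[X], derivative R = P := by
  induction P using Polynomial.induction_on' with
  | add p q hp hq =>
    obtain ⟨r, rfl⟩ := hp
    obtain ⟨s, rfl⟩ := hq
    exact ⟨r + s, by simp⟩
  | monomial n a =>
    refine ⟨monomial (n + 1) (a / (n + 1)), ?_⟩
    rw [derivative_monomial]
    have : (n : ℂ) + 1 ≠ 0 := by exact_mod_cast Nat.succ_ne_zero n
    simp [this]

/-- The complexification of a space of real functions. -/
def qeCplx (V : Submodule ℝ (ℝ → ℝ)) : Submodule ℂ (ℝ → ℂ) where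
  carrier := {F | (fun x => (F x).re) ∈ V ∧ (fun x => (F x).im) ∈ V}
  add_mem' := by
    rintro F G ⟨h1, h2⟩ ⟨h3, h4⟩
    exact ⟨V.add_mem h1 h3, V.add_mem h2 h4⟩
  zero_mem' := ⟨V.zero_mem, V.zero_mem⟩
  smul_mem' := by
    rintro c F ⟨h1, h2⟩
    refine ⟨?_, ?_⟩
    · have := V.sub_mem (V.smul_mem c.re h1) (V.smul_mem c.im h2)
      convert this using 1
      ext x
      simp
    · have := V.add_mem (V.smul_mem c.re h2) (V.smul_mem c.im h1)
      convert this using 1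
      ext x
      simp

lemma mem_qeCplx {V : Submodule ℝ (ℝ → ℝ)} {F : ℝ → ℂ} :
    F ∈ qeCplx V ↔ (fun x => (F x).re) ∈ V ∧ (fun x => (F x).im) ∈ V := Iff.rfl

lemma qeCplx_finite (V : Submodule ℝ (ℝ → ℝ)) [FiniteDimensional ℝ V] :
    FiniteDimensional ℂ (qeCplx V) := by
  let φ : qeCplx V →ₗ[ℝ] V × V :=
    { toFun := fun F => (⟨_, F.2.1⟩, ⟨_, F.2.2⟩)
      map_add' := by
        intro F G
        rfl
      map_smul' := by
        intro c F
        ext x <;> simp }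
  have hφ : Function.Injective φ := by
    intro F G h
    ext x
    have h1 := congrArg (fun p : V × V => (p.1 : ℝ → ℝ) x) h
    have h2 := congrArg (fun p : V × V => (p.2 : ℝ → ℝ) x) h
    exact Complex.ext h1 h2
  have : FiniteDimensional ℝ (qeCplx V) := FiniteDimensional.of_injective φ hφ
  exact FiniteDimensional.right ℝ ℂ _

lemma qe_hasDerivAt {V : Submodule ℝ (ℝ → ℝ)} (hV : ∀ g ∈ V, ContDiff ℝ (⊤ : ℕ∞) g)
    {F : ℝ → ℂ} (hF : F ∈ qeCplx V) (x : ℝ) :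
    HasDerivAt F (⟨deriv (fun x => (F x).re) x, deriv (fun x => (F x).im) x⟩ : ℂ) x := by
  have h1 : HasDerivAt (fun x => (F x).re) _ x :=
    ((hV _ hF.1).differentiable (by simp) x).hasDerivAt
  have h2 : HasDerivAt (fun x => (F x).im) _ x :=
    ((hV _ hF.2).differentiable (by simp) x).hasDerivAt
  have h3 := h1.ofReal_comp.fun_add (h2.ofReal_comp.mul_const Complex.I)
  simp only [Complex.re_add_im] at h3
  rw [← Complex.mk_eq_add_mul_I] at h3
  exact h3

lemma qe_deriv_mem {V : Submodule ℝ (ℝ → ℝ)} (hV : ∀ g ∈ V, ContDiff ℝ (⊤ : ℕ∞) g)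
    (hD : ∀ g ∈ V, deriv g ∈ V) {F : ℝ → ℂ} (hF : F ∈ qeCplx V) : deriv F ∈ qeCplx V := by
  have h : deriv F = fun x => (⟨deriv (fun x => (F x).re) x, deriv (fun x => (F x).im) x⟩ : ℂ) :=
    funext fun x => (qe_hasDerivAt hV hF x).deriv
  rw [h]
  exact ⟨hD _ hF.1, hD _ hF.2⟩

/-- Differentiation on the complexification. -/
noncomputable def qeD (V : Submodule ℝ (ℝ → ℝ)) (hV : ∀ g ∈ V, ContDiff ℝ (⊤ : ℕ∞) g)
    (hD : ∀ g ∈ V, deriv g ∈ V) : Module.End ℂ (qeCplx V) where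
  toFun F := ⟨deriv F.1, qe_deriv_mem hV hD F.2⟩
  map_add' F G := by
    ext x
    exact deriv_add (qe_hasDerivAt hV F.2 x).differentiableAt
      (qe_hasDerivAt hV G.2 x).differentiableAt
  map_smul' c F := by
    ext x
    exact deriv_const_smul c (qe_hasDerivAt hV F.2 x).differentiableAt

open Polynomial in
lemma qe_genEigen (V : Submodule ℝ (ℝ → ℝ)) (hV : ∀ g ∈ V, ContDiff ℝ (⊤ : ℕ∞) g)
    (hD : ∀ g ∈ V, deriv g ∈ V) (a : ℂ) (k : ℕ) (F : qeCplx V)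
    (h : ((qeD V hV hD - a • 1) ^ k) F = 0) :
    ∃ P : ℂ[X], ∀ x : ℝ, F.1 x = P.eval (x : ℂ) * Complex.exp (a * x) := by
  induction k generalizing F with
  | zero =>
    refine ⟨0, fun x => ?_⟩
    have : F = 0 := by simpa using h
    simp [this]
  | succ k ih =>
    rw [pow_succ, Module.End.mul_apply] at h
    obtain ⟨P, hP⟩ := ih _ h
    obtain ⟨R, rfl⟩ := qe_exists_antideriv P
    have hP' : ∀ x : ℝ, deriv F.1 x - a * F.1 x =
      (derivative R).eval (x : ℂ) * Complex.exp (a * x) := fun x => hP x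
    have hd : ∀ x : ℝ, HasDerivAt
        (fun x : ℝ => F.1 x * Complex.exp (-(a * x)) - R.eval (x : ℂ)) 0 x := by
      intro x
      have h1 : HasDerivAt F.1 (deriv F.1 x) x :=
        (qe_hasDerivAt hV F.2 x).differentiableAt.hasDerivAt
      have h0 : HasDerivAt (fun x : ℝ => (x : ℂ)) 1 x := Complex.ofRealCLM.hasDerivAt
      have h2 := ((h0.const_mul a).fun_neg).cexp
      have h3 := (R.hasDerivAt (x : ℂ)).comp_ofReal
      refine ((h1.fun_mul h2).fun_sub h3).congr_deriv ?_
      have e : Complex.exp (a * x) * Complex.exp (-(a * x)) = 1 := by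
        rw [← Complex.exp_add]; simp
      have := hP' x
      linear_combination (Complex.exp (-(a * x))) * this + (derivative R).eval (x : ℂ) * e
    have hc := is_const_of_deriv_eq_zero (fun x => (hd x).differentiableAt)
      (fun x => (hd x).deriv)
    refine ⟨R + C (F.1 0 - R.eval 0), fun x => ?_⟩
    have := hc x 0
    have e : Complex.exp (a * x) * Complex.exp (-(a * x)) = 1 := by
      rw [← Complex.exp_add]; simp
    simp only [Complex.ofReal_zero, mul_zero, neg_zero, Complex.exp_zero, mul_one] at this
    simp only [eval_add, eval_C]
    linear_combination Complex.exp (a * x) * this - F.1 x * e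

/-- The generating set. -/
def qeGen (I : Set ℝ) (J : Set (ℝ × ℝ)) (p : ℕ) : Set (ℝ → ℝ) :=
  {g : ℝ → ℝ | ∃ l ∈ I, ∃ j ≤ p, g = fun x => x ^ j * Real.exp (l * x)} ∪
         {g : ℝ → ℝ | ∃ q ∈ J, ∃ j ≤ p,
            (g = fun x => x ^ j * Real.exp (q.1 * x) * Real.cos (q.2 * x)) ∨
            (g = fun x => x ^ j * Real.exp (q.1 * x) * Real.sin (q.2 * x))}

lemma qeGen_mono {I I' : Set ℝ} {J J' : Set (ℝ × ℝ)} {p p' : ℕ} (hI : I ⊆ I') (hJ : J ⊆ J')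
    (hp : p ≤ p') : qeGen I J p ⊆ qeGen I' J' p' := by
  rintro g (⟨l, hl, j, hj, h⟩ | ⟨q, hq, j, hj, h⟩)
  · exact Or.inl ⟨l, hI hl, j, hj.trans hp, h⟩
  · exact Or.inr ⟨q, hJ hq, j, hj.trans hp, h⟩

/-- The space of quasi-exponential functions. -/
def qeR : Submodule ℝ (ℝ → ℝ) where
  carrier := {f | ∃ (I : Finset ℝ) (J : Finset (ℝ × ℝ)) (p : ℕ), (∀ q ∈ J, 0 < q.2) ∧
      f ∈ Submodule.span ℝ (qeGen I J p)}
  zero_mem' := ⟨∅, ∅, 0, by simp, Submodule.zero_mem _⟩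
  smul_mem' := by
    rintro c f ⟨I, J, p, h, hf⟩
    exact ⟨I, J, p, h, Submodule.smul_mem _ _ hf⟩
  add_mem' := by
    classical
    rintro f g ⟨I, J, p, h, hf⟩ ⟨I', J', p', h', hg⟩
    refine ⟨I ∪ I', J ∪ J', max p p', ?_, Submodule.add_mem _ ?_ ?_⟩
    · intro q hq
      rcases Finset.mem_union.1 hq with hq | hq
      · exact h q hq
      · exact h' q hq
    · exact Submodule.span_mono (qeGen_mono (by simp) (by simp) (by simp)) hf
    · exact Submodule.span_mono (qeGen_mono (by simp) (by simp) (by simp)) hg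

lemma qeR_exp (m : ℝ) (j : ℕ) : (fun x : ℝ => x ^ j * Real.exp (m * x)) ∈ qeR :=
  ⟨{m}, ∅, j, by simp, Submodule.subset_span (Or.inl ⟨m, by simp, j, le_rfl, rfl⟩)⟩

lemma qeR_cos (m n : ℝ) (j : ℕ) :
    (fun x : ℝ => x ^ j * Real.exp (m * x) * Real.cos (n * x)) ∈ qeR := by
  rcases lt_trichotomy n 0 with hn | rfl | hn
  · refine ⟨∅, {(m, -n)}, j, by simpa using hn,
      Submodule.subset_span (Or.inr ⟨(m, -n), by simp, j, le_rfl, Or.inl ?_⟩)⟩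
    ext x
    simp
  · simpa using qeR_exp m j
  · exact ⟨∅, {(m, n)}, j, by simpa using hn,
      Submodule.subset_span (Or.inr ⟨(m, n), by simp, j, le_rfl, Or.inl rfl⟩)⟩

lemma qeR_sin (m n : ℝ) (j : ℕ) :
    (fun x : ℝ => x ^ j * Real.exp (m * x) * Real.sin (n * x)) ∈ qeR := by
  rcases lt_trichotomy n 0 with hn | rfl | hn
  · rw [← neg_mem_iff]
    refine ⟨∅, {(m, -n)}, j, by simpa using hn,
      Submodule.subset_span (Or.inr ⟨(m, -n), by simp, j, le_rfl, Or.inr ?_⟩)⟩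
    ext x
    simp
  · simp only [zero_mul, Real.sin_zero, mul_zero]
    exact qeR.zero_mem
  · exact ⟨∅, {(m, n)}, j, by simpa using hn,
      Submodule.subset_span (Or.inr ⟨(m, n), by simp, j, le_rfl, Or.inr rfl⟩)⟩

lemma qe_monomial (a : ℂ) (j : ℕ) :
    (fun x : ℝ => (x : ℂ) ^ j * Complex.exp (a * x)) ∈ qeCplx qeR := by
  rw [mem_qeCplx]
  constructor
  · convert qeR_cos a.re a.im j using 2 with x
    rw [← Complex.ofReal_pow, Complex.re_ofReal_mul, Complex.exp_re]
    simp [mul_assoc]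
  · convert qeR_sin a.re a.im j using 2 with x
    rw [← Complex.ofReal_pow, Complex.im_ofReal_mul, Complex.exp_im]
    simp [mul_assoc]

open Polynomial in
lemma qe_poly (a : ℂ) (P : ℂ[X]) :
    (fun x : ℝ => P.eval (x : ℂ) * Complex.exp (a * x)) ∈ qeCplx qeR := by
  induction P using Polynomial.induction_on' with
  | add p q hp hq =>
    convert (qeCplx qeR).add_mem hp hq using 1
    ext x
    simp [add_mul]
  | monomial n c =>
    convert (qeCplx qeR).smul_mem c (qe_monomial a n) using 1
    ext x
    simp [mul_assoc]

lemma qe_forward (V : Submodule ℝ (ℝ → ℝ)) [FiniteDimensional ℝ V]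
    (hV : ∀ g ∈ V, ContDiff ℝ (⊤ : ℕ∞) g) (hD : ∀ g ∈ V, deriv g ∈ V)
    (f : ℝ → ℝ) (hf : f ∈ V) : f ∈ qeR := by
  have := qeCplx_finite V
  have htop := Module.End.iSup_maxGenEigenspace_eq_top (qeD V hV hD)
  have hle : (⊤ : Submodule ℂ (qeCplx V)) ≤ (qeCplx qeR).comap (qeCplx V).subtype := by
    rw [← htop]
    refine iSup_le fun a F hF => ?_
    obtain ⟨k, hk⟩ := Module.End.mem_maxGenEigenspace _ _ _ |>.1 hF
    obtain ⟨P, hP⟩ := qe_genEigen V hV hD a k F hk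
    rw [Submodule.mem_comap]
    convert qe_poly a P using 1
    ext x
    exact hP x
  have hF : (fun x => (f x : ℂ)) ∈ qeCplx V := by
    rw [mem_qeCplx]
    refine ⟨by simpa using hf, ?_⟩
    simp only [Complex.ofReal_im]
    exact V.zero_mem
  have := hle (Submodule.mem_top (x := ⟨_, hF⟩))
  have h2 : (fun x => ((f x : ℂ)).re) ∈ qeR := this.1
  simpa using h2

lemma qeGen_finite (I : Finset ℝ) (J : Finset (ℝ × ℝ)) (p : ℕ) : (qeGen I J p).Finite := by
  apply Set.Finite.union
  · apply ((I ×ˢ Finset.range (p + 1)).finite_toSet.image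
      (fun t : ℝ × ℕ => fun x : ℝ => x ^ t.2 * Real.exp (t.1 * x))).subset
    rintro g ⟨l, hl, j, hj, rfl⟩
    exact ⟨(l, j), by simp at hl ⊢; exact ⟨hl, by omega⟩, rfl⟩
  · apply (((J ×ˢ Finset.range (p + 1)).finite_toSet.image
      (fun t : (ℝ × ℝ) × ℕ => fun x : ℝ =>
        x ^ t.2 * Real.exp (t.1.1 * x) * Real.cos (t.1.2 * x))).union
      ((J ×ˢ Finset.range (p + 1)).finite_toSet.image
      (fun t : (ℝ × ℝ) × ℕ => fun x : ℝ =>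
        x ^ t.2 * Real.exp (t.1.1 * x) * Real.sin (t.1.2 * x)))).subset
    rintro g ⟨q, hq, j, hj, rfl | rfl⟩
    · exact Or.inl ⟨(q, j), by simp at hq ⊢; exact ⟨hq, by omega⟩, rfl⟩
    · exact Or.inr ⟨(q, j), by simp at hq ⊢; exact ⟨hq, by omega⟩, rfl⟩

lemma qeGen_contDiff {I : Set ℝ} {J : Set (ℝ × ℝ)} {p : ℕ} {g : ℝ → ℝ}
    (hg : g ∈ Submodule.span ℝ (qeGen I J p)) : ContDiff ℝ (⊤ : ℕ∞) g := by
  induction hg using Submodule.span_induction with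
  | mem g hg =>
    rcases hg with ⟨l, hl, j, hj, rfl⟩ | ⟨q, hq, j, hj, rfl | rfl⟩ <;> fun_prop
  | zero => exact contDiff_const
  | add f g _ _ hf hg => exact hf.add hg
  | smul c f _ hf => exact contDiff_const.smul hf

lemma qeGen_deriv {I : Set ℝ} {J : Set (ℝ × ℝ)} {p : ℕ} {g : ℝ → ℝ}
    (hg : g ∈ Submodule.span ℝ (qeGen I J p)) :
    deriv g ∈ Submodule.span ℝ (qeGen I J p) := by
  have hdiff : ∀ {g : ℝ → ℝ}, g ∈ Submodule.span ℝ (qeGen I J p) → Differentiable ℝ g :=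
    fun hg => (qeGen_contDiff hg).differentiable (by simp)
  induction hg using Submodule.span_induction with
  | mem g hg =>
    have hpow : ∀ (j : ℕ) (x : ℝ), HasDerivAt (fun x : ℝ => x ^ j) (j * x ^ (j - 1)) x :=
      fun j x => hasDerivAt_pow j x
    have hexp : ∀ m x : ℝ, HasDerivAt (fun x : ℝ => Real.exp (m * x)) (Real.exp (m * x) * m) x :=
      fun m x => by simpa using ((hasDerivAt_id x).const_mul m).exp
    have hcos : ∀ m x : ℝ, HasDerivAt (fun x : ℝ => Real.cos (m * x)) (-Real.sin (m * x) * m) x :=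
      fun m x => by simpa using ((hasDerivAt_id x).const_mul m).cos
    have hsin : ∀ m x : ℝ, HasDerivAt (fun x : ℝ => Real.sin (m * x)) (Real.cos (m * x) * m) x :=
      fun m x => by simpa using ((hasDerivAt_id x).const_mul m).sin
    rcases hg with ⟨l, hl, j, hj, rfl⟩ | ⟨q, hq, j, hj, rfl | rfl⟩
    · have hs : ∀ i ≤ p, (fun x : ℝ => x ^ i * Real.exp (l * x)) ∈
          Submodule.span ℝ (qeGen I J p) := fun i hi =>
        Submodule.subset_span (Or.inl ⟨l, hl, i, hi, rfl⟩)
      convert Submodule.add_mem _ (Submodule.smul_mem _ (j : ℝ) (hs (j - 1) (by omega)))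
        (Submodule.smul_mem _ l (hs j hj)) using 1
      ext x
      rw [((hpow j x).fun_mul (hexp l x)).deriv]
      simp only [Pi.add_apply, Pi.smul_apply, smul_eq_mul]
      ring
    all_goals
      have hc : ∀ i ≤ p, (fun x : ℝ => x ^ i * Real.exp (q.1 * x) * Real.cos (q.2 * x)) ∈
          Submodule.span ℝ (qeGen I J p) := fun i hi =>
        Submodule.subset_span (Or.inr ⟨q, hq, i, hi, Or.inl rfl⟩)
      have hs : ∀ i ≤ p, (fun x : ℝ => x ^ i * Real.exp (q.1 * x) * Real.sin (q.2 * x)) ∈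
          Submodule.span ℝ (qeGen I J p) := fun i hi =>
        Submodule.subset_span (Or.inr ⟨q, hq, i, hi, Or.inr rfl⟩)
    · convert Submodule.add_mem _ (Submodule.add_mem _
        (Submodule.smul_mem _ (j : ℝ) (hc (j - 1) (by omega)))
        (Submodule.smul_mem _ q.1 (hc j hj))) (Submodule.smul_mem _ (-q.2) (hs j hj)) using 1
      ext x
      rw [(((hpow j x).fun_mul (hexp q.1 x)).fun_mul (hcos q.2 x)).deriv]
      simp only [Pi.add_apply, Pi.smul_apply, smul_eq_mul]
      ring
    · convert Submodule.add_mem _ (Submodule.add_mem _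
        (Submodule.smul_mem _ (j : ℝ) (hs (j - 1) (by omega)))
        (Submodule.smul_mem _ q.1 (hs j hj))) (Submodule.smul_mem _ q.2 (hc j hj)) using 1
      ext x
      rw [(((hpow j x).fun_mul (hexp q.1 x)).fun_mul (hsin q.2 x)).deriv]
      simp only [Pi.add_apply, Pi.smul_apply, smul_eq_mul]
      ring
  | zero =>
    have : deriv (0 : ℝ → ℝ) = 0 := by
      ext x
      simp
    rw [this]
    exact Submodule.zero_mem _
  | add f g hf hg ihf ihg =>
    convert Submodule.add_mem _ ihf ihg using 1
    ext x
    exact deriv_add (hdiff hf x) (hdiff hg x)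
  | smul c f hf ih =>
    convert Submodule.smul_mem _ c ih using 1
    ext x
    exact deriv_const_smul c (hdiff hf x)

/-- Characterization of quasi-exponential functions.
A function `f : ℝ → ℝ` belongs to some finite dimensional subspace of smooth functions which
is invariant under differentiation if and only if `f` is a finite linear combination of the
functions `x ↦ xʲ exp(λ x)` (`λ ∈ I`, `j ≤ p`) and `x ↦ xʲ exp(μ x) cos(ν x)`,
`x ↦ xʲ exp(μ x) sin(ν x)` (`(μ, ν) ∈ J`, `j ≤ p`) for some finite sets `I ⊂ ℝ`,
`J ⊂ ℝ × (0, ∞)` and some `p ∈ ℕ₀`. -/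
theorem stmt9 (f : ℝ → ℝ) :
    (∃ V : Submodule ℝ (ℝ → ℝ), FiniteDimensional ℝ V ∧
      (∀ g ∈ V, ContDiff ℝ (⊤ : ℕ∞) g) ∧ (∀ g ∈ V, deriv g ∈ V) ∧ f ∈ V) ↔
    (∃ (I : Finset ℝ) (J : Finset (ℝ × ℝ)) (p : ℕ), (∀ q ∈ J, 0 < q.2) ∧
      f ∈ Submodule.span ℝ
        ({g : ℝ → ℝ | ∃ l ∈ I, ∃ j ≤ p, g = fun x => x ^ j * Real.exp (l * x)} ∪
         {g : ℝ → ℝ | ∃ q ∈ J, ∃ j ≤ p,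
            (g = fun x => x ^ j * Real.exp (q.1 * x) * Real.cos (q.2 * x)) ∨
            (g = fun x => x ^ j * Real.exp (q.1 * x) * Real.sin (q.2 * x))})) := by
  constructor
  · rintro ⟨V, hfin, hV, hD, hf⟩
    exact qe_forward V hV hD f hf
  · rintro ⟨I, J, p, -, hf⟩
    exact ⟨Submodule.span ℝ (qeGen I J p),
      FiniteDimensional.span_of_finite ℝ (qeGen_finite I J p),
      fun g hg => qeGen_contDiff hg, fun g hg => qeGen_deriv hg, hf⟩
end

section
/- Let α > 0 and set w(x) := exp(α x). Define g : ℝ₊ → ℝ as the pointwise sum g = Σ_{n∈ℕ₀} 𝟙_{[n, n + 2^{−n} w(n)^{−1}]} of indicator functions, and let h₀ : ℝ₊ → ℝ be the absolutely continuous function h₀(x) := ∫₀ˣ g(y) dy. Then: (1) ∫₀^∞ g(x)² w(x) dx < ∞ (so that h₀ belongs to the forward curve space with weight w); and (2) for every t ∈ ℝ₊, the translated function x ↦ h₀(x + t) on ℝ₊ is not continuously differentiable; in fact there exists a point x > 0 at which x ↦ h₀(x + t) fails to be differentiable. -/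
open MeasureTheory

/-- Example of a forward curve leaving the domain of `d/dx` forever.
Let `α > 0`, `w(x) = exp(α x)`, let `g = ∑_{n ∈ ℕ₀} 𝟙_{[n, n + 2⁻ⁿ w(n)⁻¹]}` and let
`h₀(x) = ∫₀ˣ g(y) dy`.  Then `∫₀^∞ g(x)² w(x) dx < ∞` (so `h₀` lies in the forward curve
space with weight `w`), while for every `t ≥ 0` the translate `x ↦ h₀(x + t)` is not
continuously differentiable on `ℝ₊`; in fact there is a point `x > 0` at which it fails to
be differentiable. -/
theorem stmt16 (α : ℝ) (hα : 0 < α) :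
    let w : ℝ → ℝ := fun x => Real.exp (α * x)
    let g : ℝ → ℝ := fun x => ∑' n : ℕ,
      Set.indicator (Set.Icc (n : ℝ) ((n : ℝ) + ((2 : ℝ) ^ n)⁻¹ * (w n)⁻¹))
        (fun _ => (1 : ℝ)) x
    let h₀ : ℝ → ℝ := fun x => ∫ y in (0 : ℝ)..x, g y
    IntegrableOn (fun x => g x ^ 2 * w x) (Set.Ici 0) ∧
    ∀ t : ℝ, 0 ≤ t →
      ¬ ContDiffOn ℝ 1 (fun x => h₀ (x + t)) (Set.Ici 0) ∧
      ∃ x : ℝ, 0 < x ∧ ¬ DifferentiableAt ℝ (fun y => h₀ (y + t)) x := by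
  intro w g h₀
  have hwpos : ∀ x, 0 < w x := fun x => Real.exp_pos _
  have hwc : Continuous w := by
    show Continuous (fun x : ℝ => Real.exp (α * x))
    fun_prop
  set e : ℕ → ℝ := fun n => ((2 : ℝ) ^ n)⁻¹ * (w n)⁻¹ with he
  have hw1 : ∀ n : ℕ, (w n)⁻¹ ≤ 1 := by
    intro n
    apply inv_le_one_of_one_le₀
    exact Real.one_le_exp (by positivity)
  have hepos : ∀ n, 0 < e n := fun n => mul_pos (by positivity) (inv_pos.2 (hwpos _))
  have he2 : ∀ n, e n ≤ ((2 : ℝ) ^ n)⁻¹ := fun n =>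
    mul_le_of_le_one_right (by positivity) (hw1 n)
  have he1 : ∀ n, e n ≤ 1 := fun n =>
    (he2 n).trans (inv_le_one_of_one_le₀ (one_le_pow₀ (by norm_num)))
  have hehalf : ∀ n, 1 ≤ n → e n ≤ 1 / 2 := by
    intro n hn
    refine (he2 n).trans ?_
    rw [one_div]
    apply inv_anti₀ (by norm_num)
    calc (2 : ℝ) = 2 ^ 1 := by norm_num
      _ ≤ 2 ^ n := pow_le_pow_right₀ (by norm_num) hn
  set U : Set ℝ := ⋃ n : ℕ, Set.Icc (n : ℝ) ((n : ℝ) + e n) with hU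
  have hUm : MeasurableSet U := MeasurableSet.iUnion fun n => measurableSet_Icc
  have hgU : ∀ x : ℝ, x ∉ Set.range (fun n : ℕ => (n : ℝ)) →
      g x = U.indicator (fun _ => (1 : ℝ)) x := by
    intro x hx
    have hloc : ∀ n : ℕ, x ∈ Set.Icc (n : ℝ) ((n : ℝ) + e n) → (n : ℝ) < x ∧ x < n + 1 := by
      intro n hn
      refine ⟨lt_of_le_of_ne hn.1 fun h => hx ⟨n, h⟩, lt_of_le_of_ne ?_ fun h => hx ⟨n + 1, ?_⟩⟩
      · linarith [hn.2, he1 n]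
      · push_cast; exact h.symm
    by_cases hxU : x ∈ U
    · obtain ⟨n, hn⟩ := Set.mem_iUnion.1 hxU
      rw [Set.indicator_of_mem hxU]
      show (∑' m : ℕ, Set.indicator (Set.Icc (m : ℝ) ((m : ℝ) + e m)) (fun _ => (1 : ℝ)) x) = 1
      rw [tsum_eq_single n, Set.indicator_of_mem hn]
      intro m hmn
      apply Set.indicator_of_notMem
      intro hm
      have h1 := hloc n hn
      have h2 := hloc m hm
      have h3 : (m : ℝ) < (n + 1 : ℕ) := by push_cast; linarith
      have h4 : (n : ℝ) < (m + 1 : ℕ) := by push_cast; linarith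
      have h5 := Nat.cast_lt.1 h3
      have h6 := Nat.cast_lt.1 h4
      omega
    · rw [Set.indicator_of_notMem hxU]
      show (∑' m : ℕ, Set.indicator (Set.Icc (m : ℝ) ((m : ℝ) + e m)) (fun _ => (1 : ℝ)) x) = 0
      have : ∀ m : ℕ, Set.indicator (Set.Icc (m : ℝ) ((m : ℝ) + e m)) (fun _ => (1 : ℝ)) x = 0 :=
        fun m => Set.indicator_of_notMem (fun hm => hxU (Set.mem_iUnion.2 ⟨m, hm⟩)) _
      simp [this]
  have hae : ∀ᵐ x : ℝ, g x = U.indicator (fun _ => (1 : ℝ)) x := by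
    have h0 : ∀ᵐ x : ℝ, x ∉ Set.range (fun n : ℕ => (n : ℝ)) :=
      (Set.countable_range _).ae_notMem _
    filter_upwards [h0] with x hx using hgU x hx
  have hint : ∀ a b : ℝ, IntervalIntegrable (U.indicator (fun _ => (1 : ℝ))) volume a b := by
    intro a b
    rw [intervalIntegrable_iff]
    exact (integrableOn_const (by simp [Set.uIoc])).indicator hUm
  refine ⟨?_, ?_⟩
  · have hwU : IntegrableOn w U := by
      apply integrableOn_iUnion_of_summable_integral_norm
      · intro n
        exact hwc.continuousOn.integrableOn_compact isCompact_Icc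
      · refine Summable.of_nonneg_of_le (fun n => integral_nonneg fun x => norm_nonneg _)
          (f := fun n : ℕ => Real.exp α * (1 / 2 : ℝ) ^ n) ?_
          (summable_geometric_two.mul_left _)
        intro n
        have hb := norm_setIntegral_le_of_norm_le_const (μ := volume)
          (s := Set.Icc (n : ℝ) ((n : ℝ) + e n)) (f := fun x => ‖w x‖)
          (C := Real.exp α * w n) (by simp) (by
            intro x hx
            rw [norm_norm, Real.norm_of_nonneg (hwpos x).le]
            show Real.exp (α * x) ≤ Real.exp α * Real.exp (α * n)
            rw [← Real.exp_add]
            apply Real.exp_le_exp.2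
            have := he1 n
            nlinarith [hx.2])
        refine (le_abs_self _).trans (hb.trans (le_of_eq ?_))
        rw [Real.volume_real_Icc_of_le (by linarith [hepos n])]
        have := (hwpos n).ne'
        simp only [he, one_div, inv_pow]
        field_simp
        ring
    have hI : Integrable (U.indicator w) := (integrable_indicator_iff hUm).2 hwU
    refine (hI.congr ?_).integrableOn
    filter_upwards [hae] with x hx
    rw [hx]
    by_cases hxU : x ∈ U <;> simp [hxU]
  · intro t ht
    have key : ∃ x : ℝ, 0 < x ∧ ¬ DifferentiableAt ℝ (fun y => h₀ (y + t)) x := by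
      obtain ⟨N, hN⟩ := exists_nat_gt (t + 2)
      have hN2 : 2 < N := by
        have : (2 : ℝ) < N := by linarith
        exact_mod_cast this
      refine ⟨N - t, by linarith, fun hd => ?_⟩
      have hdN : DifferentiableAt ℝ h₀ N := by
        have h1 : DifferentiableAt ℝ (fun z : ℝ => z - t) (N : ℝ) := by fun_prop
        have h2 := DifferentiableAt.comp (N : ℝ) (g := fun y => h₀ (y + t)) hd h1
        have h3 : ((fun y => h₀ (y + t)) ∘ fun z : ℝ => z - t) = h₀ := by
          funext z; simp
        rwa [h3] at h2
      have hF : ∀ x, h₀ x = ∫ y in (0 : ℝ)..x, U.indicator (fun _ => (1 : ℝ)) y := by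
        intro x
        apply intervalIntegral.integral_congr_ae
        filter_upwards [hae] with y hy _ using hy
      have hsub : ∀ a b, h₀ b - h₀ a = ∫ y in a..b, U.indicator (fun _ => (1 : ℝ)) y := by
        intro a b
        rw [hF, hF]
        exact intervalIntegral.integral_interval_sub_left (hint _ _) (hint _ _)
      have hright : ∀ y ∈ Set.Icc (N : ℝ) (N + e N), h₀ y = h₀ N + (y - N) := by
        intro y hy
        have h1 := hsub N y
        have h2 : (∫ y in (N : ℝ)..y, U.indicator (fun _ => (1 : ℝ)) y)
            = ∫ y in (N : ℝ)..y, (1 : ℝ) := by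
          apply intervalIntegral.integral_congr
          intro z hz
          rw [Set.uIcc_of_le hy.1] at hz
          have hzU : z ∈ U := Set.mem_iUnion.2 ⟨N, hz.1, hz.2.trans hy.2⟩
          exact Set.indicator_of_mem hzU _
        rw [h2, intervalIntegral.integral_const, smul_eq_mul, mul_one] at h1
        linarith
      have hleft : ∀ y ∈ Set.Ioc ((N : ℝ) - 1 / 2) N, h₀ y = h₀ N := by
        intro y hy
        have h1 := hsub y N
        have h2 : (∫ y in y..(N : ℝ), U.indicator (fun _ => (1 : ℝ)) y)
            = ∫ y in y..(N : ℝ), (0 : ℝ) := by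
          apply intervalIntegral.integral_congr_ae
          have hne : ∀ᵐ z : ℝ, z ≠ N := by
            simpa using (Set.countable_singleton (N : ℝ)).ae_notMem volume
          filter_upwards [hne] with z hzN hz
          rw [Set.uIoc_of_le hy.2] at hz
          apply Set.indicator_of_notMem
          intro hzU
          obtain ⟨m, hm⟩ := Set.mem_iUnion.1 hzU
          have hzlt : z < N := lt_of_le_of_ne hz.2 hzN
          have hmN : m < N := by exact_mod_cast hm.1.trans_lt hzlt
          have hmN' : (m : ℝ) + 1 ≤ N := by exact_mod_cast hmN
          have hm1 : 1 ≤ m := by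
            by_contra hcon
            have hm0 : m = 0 := by omega
            subst hm0
            have a1 := hm.2
            have a2 := he1 0
            push_cast at a1
            linarith [hz.1, hy.1]
          linarith [hm.2, hehalf m hm1, hz.1, hy.1]
        rw [h2, intervalIntegral.integral_zero] at h1
        linarith
      have hD := hdN.hasDerivAt
      have hR : HasDerivWithinAt h₀ 1 (Set.Ici (N : ℝ)) N := by
        have h1 : HasDerivWithinAt (fun y : ℝ => h₀ N + (y - N)) 1 (Set.Ici (N : ℝ)) N :=
          (((hasDerivAt_id (N : ℝ)).sub_const (N : ℝ)).const_add (h₀ N)).hasDerivWithinAt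
        refine h1.congr_of_eventuallyEq ?_ (by simp)
        filter_upwards [Icc_mem_nhdsGE (show (N : ℝ) < N + e N by linarith [hepos N])]
          with y hy using hright y hy
      have hL : HasDerivWithinAt h₀ 0 (Set.Iic (N : ℝ)) N := by
        refine (hasDerivWithinAt_const (N : ℝ) (Set.Iic (N : ℝ)) (h₀ N)).congr_of_eventuallyEq
          ?_ rfl
        filter_upwards [Ioc_mem_nhdsLE (show (N : ℝ) - 1 / 2 < N by linarith)]
          with y hy using hleft y hy
      have e1 := (uniqueDiffWithinAt_Ici (N : ℝ)).eq_deriv _ hD.hasDerivWithinAt hR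
      have e2 := (uniqueDiffWithinAt_Iic (N : ℝ)).eq_deriv _ hD.hasDerivWithinAt hL
      rw [e1] at e2
      exact one_ne_zero e2
    refine ⟨fun hc => ?_, key⟩
    obtain ⟨x, hx, hnd⟩ := key
    exact hnd ((hc.differentiableOn (by norm_num) x hx.le).differentiableAt (Ici_mem_nhds hx))
end
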